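/- Fix an integer N ≥ 2. For every countable family 𝒯 = {T_1, T_2, ...} of regular linear transformations, the intersection ⋂_{T ∈ 𝒯} R_T is residual in [0,1], where R_T := {x ∈ [0,1] : the sequence (Π^T(x,m))_m accumulates at every point of Δ_N}. -/

import Mathlib

open Filter Topology

/-- The `j`-th digit (for `j ≥ 1`) of the unique non-terminating base-`N` expansion
of `x ∈ [0,1]`. -/
noncomputable def digit (N : ℕ) (x : ℝ) (j : ℕ) : ℕ :=
  (⌈(N : ℝ) ^ j * x⌉ - (N : ℤ) * ⌈(N : ℝ) ^ (j - 1) * x⌉ + (N : ℤ) - 1).toNat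

/-- `freqVec N x n i = Π_i(x,n)`, the frequency of digit `i` among the first `n` digits. -/
noncomputable def freqVec (N : ℕ) (x : ℝ) (n : ℕ) : Fin N → ℝ :=
  fun i => (((Finset.Icc 1 n).filter (fun j => digit N x j = i.val)).card : ℝ) / n

/-- `p` is an accumulation point of the sequence `v` w.r.t. the ℓ¹ norm. -/
def IsAccPt1 (N : ℕ) (v : ℕ → Fin N → ℝ) (p : Fin N → ℝ) : Prop :=
  ∃ φ : ℕ → ℕ, StrictMono φ ∧
    Tendsto (fun u => ∑ k, |v (φ u) k - p k|) atTop (𝓝 0)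

/-- The series `Σ f n` converges (in the classical sense) to `t`. -/
def SeriesTo (f : ℕ → ℝ) (t : ℝ) : Prop :=
  Tendsto (fun K => ∑ n ∈ Finset.range K, f n) atTop (𝓝 t)

/-- `c` is a linear transformation: the series `Σ_n c m n * s n` converges for every
convergent sequence `s` and every row `m`. -/
def IsLinTrans (c : ℕ → ℕ → ℝ) : Prop :=
  ∀ s : ℕ → ℝ, (∃ l, Tendsto s atTop (𝓝 l)) → ∀ m, ∃ t, SeriesTo (fun n => c m n * s n) t

/-- `c` is a regular linear transformation: moreover, the averaged sequence converges to
the same limit. -/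
def IsRegularLT (c : ℕ → ℕ → ℝ) : Prop :=
  IsLinTrans c ∧
    ∀ (s : ℕ → ℝ) (l : ℝ), Tendsto s atTop (𝓝 l) →
      ∀ t : ℕ → ℝ, (∀ m, SeriesTo (fun n => c m n * s n) (t m)) →
        Tendsto t atTop (𝓝 l)

/-- The `T`-averaged digit frequency vector `Π^T(x,m)`. -/
noncomputable def freqT (N : ℕ) (c : ℕ → ℕ → ℝ) (x : ℝ) (m : ℕ) : Fin N → ℝ :=
  fun i => ∑' n, c m n * freqVec N x n i

/-- `𝔻`: rational probability vectors except `(1,0,...,0)` and `(0,...,0,1)`. -/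
def Dset (N : ℕ) : Set (Fin N → ℝ) :=
  {q | q ∈ stdSimplex ℝ (Fin N) ∧ (∀ i, ∃ r : ℚ, q i = (r : ℝ)) ∧
    q ≠ (fun i => if i.val = 0 then 1 else 0) ∧
    q ≠ (fun i => if i.val = N - 1 then 1 else 0)}

/-- `𝕀`: points of `[0,1]` with non-terminating base-`N` expansion. -/
def Iset (N : ℕ) : Set ℝ :=
  {x | x ∈ Set.Icc (0 : ℝ) 1 ∧ ¬∃ n k : ℕ, k < N ^ n ∧ x = (k : ℝ) / (N : ℝ) ^ n}

/-- Property `P_{h,ψ}` of a sequence in `ℝ^N`. -/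
def PropP (N h : ℕ) (ψ : ℕ → ℕ) (v : ℕ → Fin N → ℝ) : Prop :=
  ∀ i m : ℕ, ∀ q ∈ Dset N, ∃ j : ℕ, i ≤ j ∧ (j : ℝ) / (ψ j : ℝ) ≤ 1 / (h : ℝ) ∧
    ∀ n : ℕ, j ≤ n → n ≤ ψ^[m] j → ∑ k, |v n k - q k| < 1 / (h : ℝ)

/-- Number of grid intervals of length `1/n` meeting `E`. -/
noncomputable def boxCount (E : Set ℝ) (n : ℕ) : ℕ∞ :=
  {k : ℤ | (E ∩ Set.Ico ((k : ℝ) / n) (((k : ℝ) + 1) / n)).Nonempty}.encard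

/-- Upper box (Minkowski) dimension of a subset of `ℝ`. -/
noncomputable def upperBoxDim (E : Set ℝ) : EReal :=
  Filter.limsup (fun n : ℕ =>
    if boxCount E n = ⊤ then (⊤ : EReal)
    else ((Real.log (boxCount E n).toNat / Real.log n : ℝ) : EReal)) Filter.atTop

/-- Packing dimension of a subset of `ℝ`, via countable covers:
`dim_P F = inf { sup_n upperBoxDim (E n) : F ⊆ ⋃ n, E n }`. -/
noncomputable def packingDim (F : Set ℝ) : EReal :=
  sInf ((fun E : ℕ → Set ℝ => ⨆ n, upperBoxDim (E n)) '' {E | F ⊆ ⋃ n, E n})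

/-- A sequence whose product with every convergent sequence has a convergent series is absolutely
summable. -/
lemma summable_abs_of_forall_seriesTo {a : ℕ → ℝ}
    (h : ∀ s : ℕ → ℝ, (∃ l, Tendsto s atTop (𝓝 l)) → ∃ t, SeriesTo (fun n => a n * s n) t) :
    Summable fun n => |a n| := by
  by_contra hs
  have hA : Tendsto (fun n => ∑ k ∈ Finset.range n, |a k|) atTop atTop :=
    (not_summable_iff_tendsto_nat_atTop_of_nonneg fun _ => abs_nonneg _).1 hs
  set A : ℕ → ℝ := fun n => ∑ k ∈ Finset.range n, |a k| with hAdef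
  have hA0 : ∀ n, 0 ≤ A n := fun n => Finset.sum_nonneg fun _ _ => abs_nonneg _
  have hmono : Monotone A := monotone_nat_of_le_succ fun n => by
    simp [hAdef, Finset.sum_range_succ]
  have hsq : Tendsto (fun n => 1 + √(A n)) atTop atTop :=
    tendsto_atTop_add_const_left _ _ (Real.tendsto_sqrt_atTop.comp hA)
  have hlim : Tendsto (fun n => SignType.sign (a n) * (1 + √(A (n + 1)))⁻¹ : ℕ → ℝ)
      atTop (𝓝 0) := by
    refine squeeze_zero_norm (fun n => ?_)
      (tendsto_inv_atTop_zero.comp (hsq.comp (tendsto_add_atTop_nat 1)))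
    have hpos : 0 ≤ (1 + √(A (n + 1)))⁻¹ := by positivity
    rw [norm_mul, Real.norm_of_nonneg hpos]
    refine mul_le_of_le_one_left hpos ?_
    rcases lt_trichotomy (a n) 0 with h | h | h <;> simp [h]
  obtain ⟨t, ht⟩ := h _ ⟨0, hlim⟩
  refine not_tendsto_nhds_of_tendsto_atTop ?_ t ht
  have hlow : Tendsto (fun n => √(A n) - 1) atTop atTop :=
    tendsto_atTop_add_const_right _ _ (Real.tendsto_sqrt_atTop.comp hA)
  refine tendsto_atTop_mono (fun n => ?_) hlow
  have hpos : 0 < 1 + √(A n) := by positivity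
  calc √(A n) - 1 ≤ A n * (1 + √(A n))⁻¹ := by
        rw [← div_eq_mul_inv, le_div_iff₀ hpos]
        nlinarith [Real.sq_sqrt (hA0 n)]
    _ = ∑ k ∈ Finset.range n, |a k| * (1 + √(A n))⁻¹ := by rw [Finset.sum_mul]
    _ ≤ _ := by
        refine Finset.sum_le_sum fun k hk => ?_
        rw [← mul_assoc, self_mul_sign]
        have : A (k + 1) ≤ A n := hmono (Finset.mem_range.1 hk)
        gcongr

lemma freqVec_eq_count (N : ℕ) (x : ℝ) (n : ℕ) (i : Fin N) :
    freqVec N x n i = (Nat.count (fun j => digit N x (j + 1) = i.val) n : ℝ) / n := by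
  unfold freqVec
  congr 2
  rw [Nat.count_eq_card_filter_range]
  refine (Finset.card_bij (fun j _ => j + 1) ?_ ?_ ?_).symm
  · intro j hj
    simp only [Finset.mem_filter, Finset.mem_range, Finset.mem_Icc] at hj ⊢
    exact ⟨by omega, hj.2⟩
  · intro a _ b _ hab
    simpa using hab
  · intro b hb
    simp only [Finset.mem_filter, Finset.mem_Icc] at hb
    refine ⟨b - 1, ?_, by omega⟩
    have : b - 1 + 1 = b := by omega
    simp only [Finset.mem_filter, Finset.mem_range, this]
    exact ⟨by omega, hb.2⟩

lemma abs_freqVec_le_one (N : ℕ) (x : ℝ) (n : ℕ) (i : Fin N) : |freqVec N x n i| ≤ 1 := by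
  rw [freqVec_eq_count, abs_of_nonneg (by positivity)]
  exact div_le_one_of_le₀ (by exact_mod_cast Nat.count_le _) (by positivity)

lemma eventually_ceil_mul_eq {r x : ℝ} (h : ∀ z : ℤ, r * x ≠ z) :
    ∀ᶠ y in 𝓝 x, ⌈r * y⌉ = ⌈r * x⌉ := by
  have hlt : r * x < ⌈r * x⌉ := lt_of_le_of_ne (Int.le_ceil _) (h _)
  have hgt : (⌈r * x⌉ : ℝ) - 1 < r * x := by linarith [Int.ceil_lt_add_one (r * x)]
  have hc : ContinuousAt (fun y => r * y) x := by fun_prop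
  filter_upwards [hc.eventually (eventually_lt_nhds hlt),
    hc.eventually (eventually_gt_nhds hgt)] with y h1 h2
  exact Int.ceil_eq_iff.2 ⟨h2, h1.le⟩

lemma eventually_freqVec_eq {N : ℕ} {x : ℝ} (h : ∀ (k : ℕ) (z : ℤ), (N : ℝ) ^ k * x ≠ z) (n : ℕ) :
    ∀ᶠ y in 𝓝 x, freqVec N y n = freqVec N x n := by
  have hd : ∀ᶠ y in 𝓝 x, ∀ j ∈ Finset.Icc 1 n, digit N y j = digit N x j := by
    rw [Filter.eventually_all_finset]
    intro j _
    filter_upwards [eventually_ceil_mul_eq (h j), eventually_ceil_mul_eq (h (j - 1))] with y h1 h2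
    simp only [digit, h1, h2]
  filter_upwards [hd] with y hy
  ext i
  unfold freqVec
  congr 3
  exact Finset.filter_congr fun j hj => by rw [hy j hj]

lemma summable_mul_freqVec {N : ℕ} {a : ℕ → ℝ} (ha : Summable fun n => |a n|) (x : ℝ)
    (i : Fin N) : Summable fun n => a n * freqVec N x n i := by
  refine Summable.of_norm_bounded ha fun n => ?_
  rw [norm_mul]
  exact mul_le_of_le_one_right (abs_nonneg _) (abs_freqVec_le_one N x n i)

/-- Averaged digit frequencies are continuous at points which are not `N`-adic rationals. -/
lemma continuousAt_freqT {N : ℕ} {c : ℕ → ℕ → ℝ} {x : ℝ} {m : ℕ}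
    (hc : Summable fun n => |c m n|) (h : ∀ (k : ℕ) (z : ℤ), (N : ℝ) ^ k * x ≠ z) (i : Fin N) :
    ContinuousAt (fun y => freqT N c y m i) x := by
  refine tendsto_tsum_of_dominated_convergence hc (fun n => ?_) (Eventually.of_forall fun y n => ?_)
  · refine tendsto_const_nhds.congr' ?_
    filter_upwards [eventually_freqVec_eq h n] with y hy
    rw [hy]
  · rw [norm_mul]
    exact mul_le_of_le_one_right (abs_nonneg _) (abs_freqVec_le_one N y n i)

lemma IsRegularLT.summable_abs {c : ℕ → ℕ → ℝ} (hc : IsRegularLT c) (m : ℕ) :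
    Summable fun n => |c m n| :=
  summable_abs_of_forall_seriesTo fun s hs => hc.1 s hs m

lemma IsRegularLT.tendsto_freqT {c : ℕ → ℕ → ℝ} (hc : IsRegularLT c) {N : ℕ} {x l : ℝ}
    {i : Fin N} (h : Tendsto (fun n => freqVec N x n i) atTop (𝓝 l)) :
    Tendsto (fun m => freqT N c x m i) atTop (𝓝 l) :=
  hc.2 _ l h _ fun m => (summable_mul_freqVec (hc.summable_abs m) x i).hasSum.tendsto_sum_nat

/-- A digit sequence that is not eventually `0` and not eventually `N - 1` is the sequence of digits
of a number which is not an `N`-adic rational. -/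
lemma exists_digit_eq {N : ℕ} (d : ℕ → Fin N) (h0 : ∀ k, ∃ j, (d (k + j)).val ≠ 0)
    (h1 : ∀ k, ∃ j, (d (k + j)).val + 1 ≠ N) :
    ∃ y : ℝ, 0 < y ∧ y < 1 ∧ (∀ (k : ℕ) (z : ℤ), (N : ℝ) ^ k * y ≠ z) ∧
      ∀ k, digit N y (k + 1) = d k := by
  set t : ℕ → ℝ := fun k => Real.ofDigits fun j => d (k + j) with ht
  have hN : 0 < N := Fin.pos (d 0)
  have hrec : ∀ k, N * t k = (d k).val + t (k + 1) := by
    intro k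
    have := Real.ofDigits_eq_sum_add_ofDigits (fun j => d (k + j)) 1
    have hN' : (N : ℝ) ≠ 0 := by positivity
    simp only [Finset.sum_range_one, Real.ofDigitsTerm, pow_one, zero_add, add_zero] at this
    simp only [ht]
    rw [this]
    have hshift : (fun i => d (k + (i + 1))) = fun i => d (k + 1 + i) := by
      ext i
      rw [add_comm i 1, add_assoc]
    rw [hshift]
    field_simp
  have hnn : ∀ k, 0 ≤ t k := fun k => Real.ofDigits_nonneg _
  have hle : ∀ k, t k ≤ 1 := fun k => Real.ofDigits_le_one _
  have hN1 : (1 : ℝ) ≤ N := by exact_mod_cast hN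
  have hpos : ∀ k, 0 < t k := by
    intro k
    refine lt_of_le_of_ne (hnn k) fun hk => ?_
    have hz : ∀ j, t (k + j) = 0 := by
      intro j
      induction j with
      | zero => exact hk.symm
      | succ j ih =>
        have := hrec (k + j)
        rw [ih] at this
        have h2 : (0 : ℝ) ≤ (d (k + j)).val := by positivity
        have h3 := hnn (k + j + 1)
        rw [← add_assoc]
        linarith
    obtain ⟨j, hj⟩ := h0 k
    have := hrec (k + j)
    rw [hz j, add_assoc, hz (j + 1)] at this
    apply hj
    have h4 : ((d (k + j)).val : ℝ) = 0 := by linarith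
    exact_mod_cast h4
  have hdle : ∀ k, ((d k).val : ℝ) + 1 ≤ N := fun k => by exact_mod_cast (d k).isLt
  have hlt : ∀ k, t k < 1 := by
    intro k
    refine lt_of_le_of_ne (hle k) fun hk => ?_
    have hz : ∀ j, t (k + j) = 1 := by
      intro j
      induction j with
      | zero => exact hk
      | succ j ih =>
        have := hrec (k + j)
        rw [ih] at this
        have h2 := hdle (k + j)
        have h3 := hle (k + j + 1)
        rw [← add_assoc]
        linarith
    obtain ⟨j, hj⟩ := h1 k
    have := hrec (k + j)
    rw [hz j, add_assoc, hz (j + 1)] at this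
    apply hj
    have h4 : ((d (k + j)).val : ℝ) + 1 = N := by linarith
    exact_mod_cast h4
  have hint : ∃ a : ℕ → ℤ, ∀ k,
      (N : ℝ) ^ k * t 0 = a k + t k ∧ a (k + 1) = N * a k + (d k).val := by
    refine ⟨fun k => Nat.rec 0 (fun k b => N * b + (d k).val) k, fun k => ⟨?_, rfl⟩⟩
    induction k with
    | zero => simp
    | succ k ih =>
      rw [pow_succ', mul_assoc, ih]
      push_cast
      linarith [hrec k]
  obtain ⟨a, ha⟩ := hint
  have hceil : ∀ k, ⌈(N : ℝ) ^ k * t 0⌉ = a k + 1 := fun k => by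
    rw [(ha k).1, Int.ceil_eq_iff]
    push_cast
    exact ⟨by linarith [hpos k], by linarith [hle k]⟩
  refine ⟨t 0, hpos 0, hlt 0, fun k z hz => ?_, fun k => ?_⟩
  · have h5 := hceil k
    rw [hz, Int.ceil_intCast] at h5
    rw [(ha k).1, h5] at hz
    push_cast at hz
    linarith [hlt k]
  · simp only [digit, add_tsub_cancel_right, hceil, (ha k).2]
    have : (N * a k + ((d k).val : ℤ) + 1 - N * (a k + 1) + N - 1 : ℤ) = (d k).val := by ring
    rw [this, Int.toNat_natCast]

lemma digit_shift {N : ℕ} (hN : 0 < N) (a K : ℕ) (y : ℝ) (j : ℕ) :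
    digit N ((a + y) / (N : ℝ) ^ K) (K + j + 1) = digit N y (j + 1) := by
  have hN' : (N : ℝ) ≠ 0 := by positivity
  have hc : ∀ i, ⌈(N : ℝ) ^ (K + i) * ((a + y) / (N : ℝ) ^ K)⌉
      = (N : ℤ) ^ i * a + ⌈(N : ℝ) ^ i * y⌉ := by
    intro i
    have : (N : ℝ) ^ (K + i) * ((a + y) / (N : ℝ) ^ K)
        = (((N : ℤ) ^ i * a : ℤ) : ℝ) + (N : ℝ) ^ i * y := by
      push_cast
      field_simp
      ring
    rw [this, Int.ceil_intCast_add]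
  simp only [digit, add_tsub_cancel_right, add_assoc K j 1, hc]
  simp only [← add_assoc, add_tsub_cancel_right, hc]
  congr 1
  ring

lemma count_mul_add_of_periodic {p : ℕ → Prop} [DecidablePred p] {L : ℕ}
    (hp : Function.Periodic p L) (q r : ℕ) :
    Nat.count p (L * q + r) = q * Nat.count p L + Nat.count p r := by
  induction q with
  | zero => simp
  | succ q ih =>
    have h1 : L * (q + 1) + r = L + (L * q + r) := by ring
    have h2 : ∀ k, p (L + k) ↔ p k := fun k => by rw [add_comm, hp k]
    rw [h1, Nat.count_add]
    simp only [h2]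
    rw [ih]
    ring

lemma tendsto_count_div_of_periodic {p : ℕ → Prop} [DecidablePred p] {L : ℕ} (hL : 0 < L)
    (hp : Function.Periodic p L) :
    Tendsto (fun n : ℕ => (Nat.count p n : ℝ) / n) atTop (𝓝 (Nat.count p L / L)) := by
  rw [tendsto_iff_norm_sub_tendsto_zero]
  refine squeeze_zero' (Eventually.of_forall fun _ => norm_nonneg _) ?_
    (tendsto_const_div_atTop_nhds_zero_nat (L : ℝ))
  filter_upwards [eventually_gt_atTop 0] with n hn
  have hn' : (0 : ℝ) < n := by exact_mod_cast hn
  have hL' : (0 : ℝ) < L := by exact_mod_cast hL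
  have hcount := count_mul_add_of_periodic hp (n / L) (n % L)
  rw [Nat.div_add_mod] at hcount
  have hdm : (n : ℝ) = L * (n / L : ℕ) + (n % L : ℕ) := by
    exact_mod_cast (Nat.div_add_mod n L).symm
  have hr : ((n % L : ℕ) : ℝ) ≤ L := by exact_mod_cast (Nat.mod_lt n hL).le
  have hs : (Nat.count p (n % L) : ℝ) ≤ (n % L : ℕ) := by exact_mod_cast Nat.count_le _
  have ha : (Nat.count p L : ℝ) / L ≤ 1 :=
    div_le_one_of_le₀ (by exact_mod_cast Nat.count_le _) hL'.le
  have ha0 : 0 ≤ (Nat.count p L : ℝ) / L := by positivity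
  have hs0 : (0 : ℝ) ≤ Nat.count p (n % L) := by positivity
  have hr0 : (0 : ℝ) ≤ (n % L : ℕ) := by positivity
  have key : (Nat.count p n : ℝ) / n - Nat.count p L / L
      = (Nat.count p (n % L) - (n % L : ℕ) * (Nat.count p L / L)) / n := by
    rw [hcount, Nat.cast_add, Nat.cast_mul, eq_div_iff hn'.ne', sub_mul, div_mul_cancel₀ _ hn'.ne']
    have hq : (Nat.count p L : ℝ) / L * n
        = (n / L : ℕ) * Nat.count p L + (n % L : ℕ) * (Nat.count p L / L) := by
      conv_lhs => rw [hdm]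
      field_simp
    rw [hq]
    ring
  rw [key, norm_div, Real.norm_of_nonneg hn'.le]
  gcongr
  rw [Real.norm_eq_abs, abs_le]
  constructor <;> nlinarith

lemma tendsto_count_div_of_shift {p : ℕ → Prop} [DecidablePred p] {l : ℝ} (K : ℕ)
    (h : Tendsto (fun n : ℕ => (Nat.count (fun j => p (K + j)) n : ℝ) / n) atTop (𝓝 l)) :
    Tendsto (fun n : ℕ => (Nat.count p n : ℝ) / n) atTop (𝓝 l) := by
  rw [← tendsto_add_atTop_iff_nat K]
  have h1 : Tendsto (fun n : ℕ => ((Nat.count p K : ℝ) / n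
      + (Nat.count (fun j => p (K + j)) n : ℝ) / n) * ((n : ℝ) / (n + K))) atTop
      (𝓝 ((0 + l) * 1)) :=
    ((tendsto_const_div_atTop_nhds_zero_nat _).add h).mul (tendsto_natCast_div_add_atTop (K : ℝ))
  rw [zero_add, mul_one] at h1
  refine h1.congr' ?_
  filter_upwards [eventually_gt_atTop 0] with n hn
  have hn' : (0 : ℝ) < n := by exact_mod_cast hn
  rw [add_comm n K, Nat.count_add]
  push_cast
  field_simp
  ring

/-- There is a finite word in which each letter occurs a prescribed number of times. -/
lemma exists_word {N : ℕ} (c : Fin N → ℕ) :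
    ∃ w : Fin (∑ i, c i) → Fin N, ∀ i, (Finset.univ.filter fun k => w k = i).card = c i := by
  refine ⟨fun k => (finSigmaFinEquiv.symm k).1, fun i => ?_⟩
  rw [← Fintype.card_subtype, ← Fintype.card_fin (c i)]
  refine Fintype.card_congr
    ((finSigmaFinEquiv.symm.subtypeEquiv (q := fun s : (i : Fin N) × Fin (c i) => s.1 = i)
      fun k => Iff.rfl).trans (Equiv.sigmaSubtype i))

/-- The probability vector with weights proportional to `a i + 1`. -/
noncomputable def weightVec {N : ℕ} (a : Fin N → ℕ) : Fin N → ℝ :=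
  fun i => ((a i + 1 : ℕ) : ℝ) / ((∑ j, (a j + 1) : ℕ) : ℝ)

lemma exists_digit_seq {N : ℕ} (hN : 2 ≤ N) (a : Fin N → ℕ) :
    ∃ d : ℕ → Fin N, (∀ i k, ∃ j, d (k + j) = i) ∧
      ∀ i, Tendsto (fun n : ℕ => (Nat.count (fun j => (d j).val = i.val) n : ℝ) / n) atTop
        (𝓝 (weightVec a i)) := by
  obtain ⟨L, hLdef⟩ : ∃ L, L = ∑ i, (a i + 1) := ⟨_, rfl⟩
  obtain ⟨w, hw⟩ : ∃ w : Fin L → Fin N,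
      ∀ i, (Finset.univ.filter fun k => w k = i).card = a i + 1 :=
    hLdef ▸ exists_word fun i => a i + 1
  have hL : 0 < L := hLdef ▸ Finset.sum_pos (fun i _ => Nat.succ_pos _) ⟨⟨0, by omega⟩, Finset.mem_univ _⟩
  refine ⟨fun j => w ⟨j % L, Nat.mod_lt _ hL⟩, fun i k => ?_, fun i => ?_⟩
  · have : 0 < (Finset.univ.filter fun k => w k = i).card := by rw [hw]; omega
    obtain ⟨s, hs⟩ := Finset.card_pos.1 this
    rw [Finset.mem_filter] at hs
    refine ⟨L * k + s - k, ?_⟩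
    have h1 : k ≤ L * k := Nat.le_mul_of_pos_left k hL
    have h2 : k + (L * k + s - k) = L * k + s := by omega
    have h3 : (⟨(k + (L * k + s - k)) % L, Nat.mod_lt _ hL⟩ : Fin L) = s := by
      ext
      simp [h2, Nat.mod_eq_of_lt s.isLt]
    exact (congrArg w h3).trans hs.2
  · have hper : Function.Periodic
        (fun j => (w ⟨j % L, Nat.mod_lt _ hL⟩).val = i.val) L := fun j => by simp
    have := tendsto_count_div_of_periodic hL hper
    have hcount : Nat.count (fun j => (w ⟨j % L, Nat.mod_lt _ hL⟩).val = i.val) L = a i + 1 := by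
      rw [← hw i, Nat.count_eq_card_filter_range]
      symm
      refine Finset.card_bij (fun k _ => k.val) ?_ ?_ ?_
      · intro k hk
        rw [Finset.mem_filter] at hk ⊢
        refine ⟨Finset.mem_range.2 k.isLt, ?_⟩
        simp [Nat.mod_eq_of_lt k.isLt, hk.2]
      · intro k _ k' _ h
        exact Fin.ext h
      · intro b hb
        rw [Finset.mem_filter, Finset.mem_range] at hb
        refine ⟨⟨b, hb.1⟩, ?_, rfl⟩
        have := hb.2
        simp only [Nat.mod_eq_of_lt hb.1] at this
        simpa using Fin.ext this
    rw [hcount] at this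
    rwa [weightVec, ← hLdef]

/-- Points whose digit frequencies converge to a given weight vector and which are not `N`-adic
rationals are dense in `[0,1]`. -/
lemma dense_tendsto_freqVec {N : ℕ} (hN : 2 ≤ N) (a : Fin N → ℕ) :
    Dense {x : ↥(Set.Icc (0 : ℝ) 1) | (∀ (k : ℕ) (z : ℤ), (N : ℝ) ^ k * (x : ℝ) ≠ z) ∧
      ∀ i, Tendsto (fun n => freqVec N x n i) atTop (𝓝 (weightVec a i))} := by
  obtain ⟨d, hd, hlim⟩ := exists_digit_seq hN a
  obtain ⟨y, hy0, hy1, hyN, hy⟩ := exists_digit_eq d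
    (fun k => (hd ⟨1, by omega⟩ k).imp fun j hj => by simp [hj])
    (fun k => (hd ⟨0, by omega⟩ k).imp fun j hj => by simp [hj]; omega)
  have hNpos : (0 : ℝ) < N := by positivity
  rw [Metric.dense_iff]
  rintro ⟨x, hx0, hx1⟩ ε hε
  have hinv : (1 : ℝ) / N < 1 := by
    rw [div_lt_one hNpos]
    exact_mod_cast hN
  obtain ⟨K, hK⟩ := exists_pow_lt_of_lt_one hε hinv
  have hP : (0 : ℝ) < (N : ℝ) ^ K := by positivity
  set b : ℕ := ⌈(N : ℝ) ^ K * x⌉₊ - 1 with hb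
  have hb1 : (N : ℝ) ^ K * x ≤ b + 1 := by
    refine (Nat.le_ceil _).trans ?_
    exact_mod_cast (by omega : ⌈(N : ℝ) ^ K * x⌉₊ ≤ b + 1)
  have hb0 : (b : ℝ) ≤ (N : ℝ) ^ K * x := by
    have h0 : 0 ≤ (N : ℝ) ^ K * x := by positivity
    rcases Nat.eq_zero_or_pos ⌈(N : ℝ) ^ K * x⌉₊ with h | h
    · rw [hb, h]; simpa using h0
    · have h2 := Nat.ceil_lt_add_one h0
      have h3 : ((b + 1 : ℕ) : ℝ) = ⌈(N : ℝ) ^ K * x⌉₊ := by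
        exact_mod_cast (by omega : b + 1 = ⌈(N : ℝ) ^ K * x⌉₊)
      push_cast at h3
      linarith
  have hbN : (b : ℝ) + 1 ≤ (N : ℝ) ^ K := by
    have h1 : ⌈(N : ℝ) ^ K * x⌉₊ ≤ N ^ K := by
      rw [Nat.ceil_le]
      push_cast
      exact mul_le_of_le_one_right hP.le hx1
    have h2 : 0 < N ^ K := by positivity
    exact_mod_cast (by omega : b + 1 ≤ N ^ K)
  have hmem : ((b + y) / (N : ℝ) ^ K) ∈ Set.Icc (0 : ℝ) 1 :=
    ⟨by positivity, by rw [div_le_one hP]; linarith⟩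
  refine ⟨⟨_, hmem⟩, ?_, ?_, ?_⟩
  · rw [Metric.mem_ball, Subtype.dist_eq, Real.dist_eq]
    refine lt_of_le_of_lt ?_ hK
    rw [one_div, inv_pow, ← one_div, le_div_iff₀ hP]
    have : |(b + y) / (N : ℝ) ^ K - x| * (N : ℝ) ^ K = |b + y - (N : ℝ) ^ K * x| := by
      nth_rewrite 2 [← abs_of_pos hP]
      rw [← abs_mul]
      congr 1
      field_simp
    rw [this]
    rw [abs_le]
    constructor <;> linarith
  · intro k z hz
    refine hyN k (N ^ K * z - N ^ k * b) ?_
    push_cast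
    rw [← hz]
    field_simp
    ring
  · intro i
    simp only [freqVec_eq_count]
    refine tendsto_count_div_of_shift K ?_
    simp only [digit_shift (by omega : 0 < N), hy]
    exact hlim i

lemma exists_weightVec_near {N : ℕ} {p : Fin N → ℝ} (hp : p ∈ stdSimplex ℝ (Fin N)) {ε : ℝ}
    (hε : 0 < ε) : ∃ a : Fin N → ℕ, ∑ k, |weightVec a k - p k| < ε := by
  have hnum : ∀ i, Tendsto (fun M : ℕ => ((⌊p i * M⌋₊ + 1 : ℕ) : ℝ) / M) atTop (𝓝 (p i)) := by
    intro i
    have h1 := ((tendsto_nat_floor_mul_div_atTop (hp.1 i)).comp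
      (tendsto_natCast_atTop_atTop (R := ℝ))).add (tendsto_const_div_atTop_nhds_zero_nat (1 : ℝ))
    rw [add_zero] at h1
    refine h1.congr fun M => ?_
    simp [add_div]
  have hden : Tendsto (fun M : ℕ => ((∑ j, (⌊p j * M⌋₊ + 1) : ℕ) : ℝ) / M) atTop (𝓝 1) := by
    rw [← hp.2]
    refine (tendsto_finsetSum Finset.univ fun i _ => hnum i).congr fun M => ?_
    rw [← Finset.sum_div, Nat.cast_sum]
  have hlim : Tendsto (fun M : ℕ => ∑ k, |weightVec (fun i => ⌊p i * M⌋₊) k - p k|) atTop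
      (𝓝 (∑ k : Fin N, |p k - p k|)) := by
    refine tendsto_finsetSum _ fun i _ => Tendsto.abs (Tendsto.sub_const ?_ _)
    have h2 := (hnum i).div hden one_ne_zero
    rw [div_one] at h2
    refine h2.congr' ?_
    filter_upwards [eventually_gt_atTop 0] with M hM
    have hM' : (M : ℝ) ≠ 0 := by positivity
    simp only [Pi.div_apply, weightVec]
    exact div_div_div_cancel_right₀ hM' _ _
  simp only [sub_self, abs_zero, Finset.sum_const_zero] at hlim
  obtain ⟨M, hM⟩ := (hlim.eventually (eventually_lt_nhds hε)).exists
  exact ⟨_, hM⟩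

lemma residual_exists_freqT_near {N : ℕ} (hN : 2 ≤ N) {c : ℕ → ℕ → ℝ} (hc : IsRegularLT c)
    (a : Fin N → ℕ) {ε : ℝ} (hε : 0 < ε) (M : ℕ) :
    ∀ᶠ x : ↥(Set.Icc (0 : ℝ) 1) in residual _,
      ∃ m, M ≤ m ∧ ∑ k, |freqT N c x m k - weightVec a k| < ε := by
  refine mem_of_superset (residual_of_dense_open isOpen_interior ?_) interior_subset
  refine (dense_tendsto_freqVec hN a).mono ?_
  rintro x ⟨hxN, hx⟩
  have hlim : Tendsto (fun m => ∑ k, |freqT N c x m k - weightVec a k|) atTop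
      (𝓝 (∑ k, |weightVec a k - weightVec a k|)) :=
    tendsto_finsetSum _ fun i _ => ((hc.tendsto_freqT (hx i)).sub_const _).abs
  simp only [sub_self, abs_zero, Finset.sum_const_zero] at hlim
  obtain ⟨m, hm, hMm⟩ :=
    ((hlim.eventually (eventually_lt_nhds hε)).and (eventually_ge_atTop M)).exists
  have hcont : ContinuousAt
      (fun y : ↥(Set.Icc (0 : ℝ) 1) => ∑ k, |freqT N c y m k - weightVec a k|) x := by
    refine tendsto_finsetSum _ fun i _ => Tendsto.abs (Tendsto.sub_const ?_ _)
    exact (continuousAt_freqT (hc.summable_abs m) hxN i).tendsto.comp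
      continuous_subtype_val.continuousAt
  rw [mem_interior_iff_mem_nhds]
  filter_upwards [hcont.eventually (eventually_lt_nhds hm)] with y hy
  exact ⟨m, hMm, hy⟩

lemma isAccPt1_of_forall_exists {N : ℕ} {v : ℕ → Fin N → ℝ} {p : Fin N → ℝ}
    (h : ∀ ε > 0, ∀ M, ∃ m, M ≤ m ∧ ∑ k, |v m k - p k| < ε) : IsAccPt1 N v p := by
  obtain ⟨φ, hφ, hlt⟩ := extraction_forall_of_frequently
    (P := fun n m => ∑ k, |v m k - p k| < 1 / ((n : ℝ) + 1))
    fun n => frequently_atTop.2 fun M => h _ (by positivity) M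
  exact ⟨φ, hφ, squeeze_zero (fun n => Finset.sum_nonneg fun _ _ => abs_nonneg _)
    (fun n => (hlt n).le) tendsto_one_div_add_atTop_nhds_zero_nat⟩

/-- For every countable family `𝒯 = {T_1, T_2, ...}` of regular linear
transformations, the intersection `⋂_{T ∈ 𝒯} R_T` is residual in `[0,1]`. -/
theorem residual_iInter_RT (N : ℕ) (hN : 2 ≤ N) (T : ℕ → (ℕ → ℕ → ℝ))
    (hT : ∀ k, IsRegularLT (T k)) :
    {x : ↥(Set.Icc (0 : ℝ) 1) |
        ∀ k : ℕ, ∀ p ∈ stdSimplex ℝ (Fin N), IsAccPt1 N (freqT N (T k) ↑x) p} ∈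
      residual ↥(Set.Icc (0 : ℝ) 1) := by
  have hres : ∀ᶠ x : ↥(Set.Icc (0 : ℝ) 1) in residual _, ∀ (k : ℕ) (a : Fin N → ℕ) (h M : ℕ),
      ∃ m, M ≤ m ∧ ∑ i, |freqT N (T k) x m i - weightVec a i| < 1 / ((h : ℝ) + 1) := by
    simp only [eventually_countable_forall]
    exact fun k a h M => residual_exists_freqT_near hN (hT k) a (by positivity) M
  filter_upwards [hres] with x hx k p hp
  refine isAccPt1_of_forall_exists fun ε hε M => ?_
  obtain ⟨a, ha⟩ := exists_weightVec_near hp (half_pos hε)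
  obtain ⟨h, hh⟩ := exists_nat_one_div_lt (half_pos hε)
  obtain ⟨m, hMm, hm⟩ := hx k a h M
  refine ⟨m, hMm, ?_⟩
  calc ∑ i, |freqT N (T k) x m i - p i|
      ≤ ∑ i, (|freqT N (T k) x m i - weightVec a i| + |weightVec a i - p i|) :=
        Finset.sum_le_sum fun i _ => abs_sub_le _ _ _
    _ < ε := by
        rw [Finset.sum_add_distrib]
        linarith
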